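/- arXiv:1911.00645 — 4 statements merged into one kernel-verified Lean document; each statement's English description precedes it below -/
import Mathlib

section
/- Let d ≥ 1, L ≥ 1 and Φ ∈ ℝ^{d×d} be arbitrary. Suppose W_1, …, W_L : [0,∞) → ℝ^{d×d} are differentiable and satisfy the continuous-time gradient descent dynamics d/dt W_l(t) = −∇_l R(t) for l = 1,…,L and t ≥ 0, with zero-asymmetric initialization W_l(0) = I for l = 1,…,L−1 and W_L(0) = 0. Then R(t) ≤ e^{−2t} R(0) for all t ≥ 0. -/
open Matrix

namespace ZAS

/-- `seg W l₁ l₂ = W l₂ * W (l₂-1) * ⋯ * W l₁` (the empty product, when `l₂ < l₁`, is `1`). -/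
noncomputable def seg {d : ℕ} (W : ℕ → Matrix (Fin d) (Fin d) ℝ) (l₁ : ℕ) :
    ℕ → Matrix (Fin d) (Fin d) ℝ
  | 0 => 1
  | (k+1) => if k + 1 < l₁ then 1 else W (k+1) * seg W l₁ k

/-- Squared Frobenius norm `‖A‖_F²`. -/
noncomputable def frobSq {m n : ℕ} (A : Matrix (Fin m) (Fin n) ℝ) : ℝ :=
  ∑ i, ∑ j, (A i j)^2

/-- Frobenius norm `‖A‖_F`. -/
noncomputable def frob {m n : ℕ} (A : Matrix (Fin m) (Fin n) ℝ) : ℝ :=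
  Real.sqrt (frobSq A)

/-- Frobenius inner product `⟨A, B⟩ = tr(Aᵀ B)`. -/
noncomputable def finner {m n : ℕ} (A B : Matrix (Fin m) (Fin n) ℝ) : ℝ :=
  ∑ i, ∑ j, A i j * B i j

/-- The loss `R(W_1, …, W_L) = (1/2) ‖W_{L:1} - Φ‖_F²`. -/
noncomputable def loss {d : ℕ} (W : ℕ → Matrix (Fin d) (Fin d) ℝ)
    (Φ : Matrix (Fin d) (Fin d) ℝ) (L : ℕ) : ℝ :=
  frobSq (seg W 1 L - Φ) / 2

/-- The gradient `∇_l R = W_{L:l+1}ᵀ (W_{L:1} - Φ) W_{l-1:1}ᵀ`. -/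
noncomputable def grad {d : ℕ} (W : ℕ → Matrix (Fin d) (Fin d) ℝ)
    (Φ : Matrix (Fin d) (Fin d) ℝ) (L l : ℕ) : Matrix (Fin d) (Fin d) ℝ :=
  (seg W (l+1) L)ᵀ * (seg W 1 L - Φ) * (seg W 1 (l-1))ᵀ

/-- The invariant matrices `D_l = W_{l+1}ᵀ W_{l+1} - W_l W_lᵀ`. -/
noncomputable def Dmat {d : ℕ} (W : ℕ → Matrix (Fin d) (Fin d) ℝ) (l : ℕ) :
    Matrix (Fin d) (Fin d) ℝ :=
  (W (l+1))ᵀ * W (l+1) - W l * (W l)ᵀ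

/-- Spectral norm (operator 2-norm) of a square real matrix. -/
noncomputable def spec {d : ℕ} (A : Matrix (Fin d) (Fin d) ℝ) : ℝ :=
  ‖Matrix.toEuclideanCLM (𝕜 := ℝ) A‖

/-- The loss on data: `R̃ = (1/2) ‖W_{L:1} X - Y‖_F²`. -/
noncomputable def lossT {d n : ℕ} (W : ℕ → Matrix (Fin d) (Fin d) ℝ)
    (X Y : Matrix (Fin d) (Fin n) ℝ) (L : ℕ) : ℝ :=
  frobSq (seg W 1 L * X - Y) / 2

/-- The gradient of the data loss: `∇_l R̃ = W_{L:l+1}ᵀ (W_{L:1} X - Y) Xᵀ W_{l-1:1}ᵀ`. -/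
noncomputable def gradT {d n : ℕ} (W : ℕ → Matrix (Fin d) (Fin d) ℝ)
    (X Y : Matrix (Fin d) (Fin n) ℝ) (L l : ℕ) : Matrix (Fin d) (Fin d) ℝ :=
  (seg W (l+1) L)ᵀ * (seg W 1 L * X - Y) * Xᵀ * (seg W 1 (l-1))ᵀ

end ZAS

namespace ZAS

section Algebra

variable {d : ℕ}

lemma seg_succ (W : ℕ → Matrix (Fin d) (Fin d) ℝ) {l n : ℕ} (h : l ≤ n + 1) :
    seg W l (n + 1) = W (n + 1) * seg W l n := by
  simp [seg, Nat.not_lt.mpr h]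

lemma seg_of_lt (W : ℕ → Matrix (Fin d) (Fin d) ℝ) {l n : ℕ} (h : n < l) :
    seg W l n = 1 := by
  cases n with
  | zero => rfl
  | succ n => simp [seg, h]

lemma seg_succ_mul (W : ℕ → Matrix (Fin d) (Fin d) ℝ) {l n : ℕ} (hl : 1 ≤ l) (h : l ≤ n) :
    seg W (l + 1) n * W l = seg W l n := by
  induction n, h using Nat.le_induction with
  | base =>
    obtain ⟨m, rfl⟩ := Nat.exists_eq_add_of_le' hl
    rw [seg_of_lt W (Nat.lt_succ_self _), seg_succ W le_rfl, seg_of_lt W (Nat.lt_succ_self _)]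
    simp
  | succ n hn ih =>
    rw [seg_succ W (by omega), seg_succ W (by omega), Matrix.mul_assoc, ih]

lemma finner_eq_trace {m n : ℕ} (A B : Matrix (Fin m) (Fin n) ℝ) :
    finner A B = (A * Bᵀ).trace := by
  simp [finner, Matrix.trace, Matrix.mul_apply]

lemma frobSq_eq_finner {m n : ℕ} (A : Matrix (Fin m) (Fin n) ℝ) : frobSq A = finner A A := by
  simp [frobSq, finner, sq]

lemma frobSq_eq_trace {m n : ℕ} (A : Matrix (Fin m) (Fin n) ℝ) :
    frobSq A = (A * Aᵀ).trace := by
  rw [frobSq_eq_finner, finner_eq_trace]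

lemma frobSq_nonneg {m n : ℕ} (A : Matrix (Fin m) (Fin n) ℝ) : 0 ≤ frobSq A :=
  Finset.sum_nonneg fun _ _ => Finset.sum_nonneg fun _ _ => sq_nonneg _

lemma frobSq_sub {m n : ℕ} (A B : Matrix (Fin m) (Fin n) ℝ) :
    frobSq (A - B) = frobSq A - 2 * finner A B + frobSq B := by
  simp only [frobSq, finner, Finset.mul_sum, ← Finset.sum_sub_distrib, ← Finset.sum_add_distrib]
  refine Finset.sum_congr rfl fun i _ => Finset.sum_congr rfl fun j _ => ?_
  rw [Matrix.sub_apply]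
  ring

lemma finner_mul_mul (E A X B : Matrix (Fin d) (Fin d) ℝ) :
    finner E (A * X * B) = finner (Aᵀ * E * Bᵀ) X := by
  simp only [finner_eq_trace, Matrix.transpose_mul]
  rw [← Matrix.mul_assoc, ← Matrix.mul_assoc, Matrix.trace_mul_comm]
  simp only [Matrix.mul_assoc]

lemma finner_sum {ι : Type*} (s : Finset ι) (E : Matrix (Fin d) (Fin d) ℝ)
    (X : ι → Matrix (Fin d) (Fin d) ℝ) :
    finner E (∑ l ∈ s, X l) = ∑ l ∈ s, finner E (X l) := by
  simp only [finner_eq_trace, Matrix.transpose_sum, Matrix.mul_sum, Matrix.trace_sum]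

lemma finner_neg (A B : Matrix (Fin d) (Fin d) ℝ) : finner A (-B) = -finner A B := by
  simp [finner]

lemma posSemidef_one_add_pow_sub_one {S : Matrix (Fin d) (Fin d) ℝ} (hS : S.PosSemidef) (k : ℕ) :
    ((1 + S) ^ k - 1).PosSemidef := by
  have h : (1 + S) ^ k - 1 = ∑ j ∈ Finset.range k, (k.choose (j + 1)) • S ^ (j + 1) := by
    rw [add_comm, (Commute.one_right S).add_pow, Finset.sum_range_succ']
    simp [nsmul_eq_mul, Nat.cast_comm]
  rw [h]
  refine Matrix.posSemidef_sum _ fun j _ => ?_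
  rw [← Nat.cast_smul_eq_nsmul ℝ]
  exact (hS.pow _).smul (Nat.cast_nonneg _)

/-- If `P Pᵀ - 1` is positive semidefinite then right multiplication by `Pᵀ` does not decrease the
Frobenius norm. -/
lemma frobSq_le_frobSq_mul_transpose {P : Matrix (Fin d) (Fin d) ℝ}
    (hP : (P * Pᵀ - 1).PosSemidef) (E : Matrix (Fin d) (Fin d) ℝ) :
    frobSq E ≤ frobSq (E * Pᵀ) := by
  have hpos : (P * Pᵀ).PosDef := by
    have := Matrix.PosDef.one.add_posSemidef hP
    rwa [add_sub_cancel] at this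
  have hdet : IsUnit P.det := by
    have h := hpos.det_pos.ne'
    rw [Matrix.det_mul] at h
    exact (left_ne_zero_of_mul h).isUnit
  set F := E * P⁻¹ with hF
  have hE : F * P = E := by
    rw [hF, Matrix.mul_assoc, Matrix.nonsing_inv_mul _ hdet, Matrix.mul_one]
  have hFE : frobSq F ≤ frobSq E := by
    have h := (hP.mul_mul_conjTranspose_same F).trace_nonneg
    rw [Matrix.conjTranspose_eq_transpose_of_trivial, Matrix.mul_sub, Matrix.sub_mul,
      Matrix.trace_sub, Matrix.mul_one] at h
    rw [frobSq_eq_trace, frobSq_eq_trace E]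
    conv_rhs => rw [← hE, Matrix.transpose_mul]
    simp only [Matrix.mul_assoc] at h ⊢
    linarith
  have hcross : finner (E * Pᵀ) F = frobSq E := by
    have h := finner_mul_mul E 1 F P
    rw [Matrix.one_mul, hE, Matrix.transpose_one, Matrix.one_mul] at h
    rw [← h, frobSq_eq_finner]
  have := frobSq_nonneg (E * Pᵀ - F)
  rw [frobSq_sub, hcross] at this
  linarith

lemma mul_transpose_mul_pow_mul (A : Matrix (Fin d) (Fin d) ℝ) (k : ℕ) :
    A * (Aᵀ * A) ^ k * Aᵀ = (A * Aᵀ) ^ (k + 1) := by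
  induction k with
  | zero => simp
  | succ k ih =>
    rw [pow_succ, pow_succ _ (k + 1), ← ih]
    simp only [Matrix.mul_assoc]

/-- For balanced factors, the Gram matrix of the product is a power of that of the last factor. -/
lemma seg_mul_transpose (W : ℕ → Matrix (Fin d) (Fin d) ℝ) (n : ℕ)
    (h : ∀ l, 1 ≤ l → l < n → Dmat W l = 0) :
    seg W 1 n * (seg W 1 n)ᵀ = (W n * (W n)ᵀ) ^ n := by
  induction n with
  | zero => simp [seg]
  | succ n ih =>
    specialize ih fun l h1 h2 => h l h1 (by omega)
    rw [seg_succ W (by omega), Matrix.transpose_mul, Matrix.mul_assoc,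
      ← Matrix.mul_assoc (seg W 1 n), ih, ← Matrix.mul_assoc]
    rcases Nat.eq_zero_or_pos n with rfl | hn
    · simp
    · rw [← sub_eq_zero.mp (h n hn (Nat.lt_succ_self n)), mul_transpose_mul_pow_mul]

lemma transpose_mul_grad (W : ℕ → Matrix (Fin d) (Fin d) ℝ) (Φ : Matrix (Fin d) (Fin d) ℝ)
    {L l : ℕ} (hl : 1 ≤ l) (h : l < L) :
    (W (l + 1))ᵀ * grad W Φ L (l + 1) = grad W Φ L l * (W l)ᵀ := by
  obtain ⟨m, rfl⟩ := Nat.exists_eq_add_of_le' hl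
  have h1 : (W (m + 1 + 1))ᵀ * (seg W (m + 1 + 1 + 1) L)ᵀ = (seg W (m + 1 + 1) L)ᵀ := by
    rw [← Matrix.transpose_mul, seg_succ_mul W (by omega) (by omega)]
  have h2 : (seg W 1 m)ᵀ * (W (m + 1))ᵀ = (seg W 1 (m + 1))ᵀ := by
    rw [← Matrix.transpose_mul, seg_succ W (by omega)]
  simp only [grad, Nat.add_sub_cancel]
  rw [← Matrix.mul_assoc, ← Matrix.mul_assoc, h1, Matrix.mul_assoc _ _ (W (m + 1))ᵀ, h2]

end Algebra

section Calculus

variable {d : ℕ}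

/-- Entrywise derivative of a matrix-valued function within a set. -/
def HasEntryDerivWithinAt (A : ℝ → Matrix (Fin d) (Fin d) ℝ) (A' : Matrix (Fin d) (Fin d) ℝ)
    (s : Set ℝ) (t : ℝ) : Prop :=
  ∀ i j, HasDerivWithinAt (fun x => A x i j) (A' i j) s t

variable {A B : ℝ → Matrix (Fin d) (Fin d) ℝ} {A' B' : Matrix (Fin d) (Fin d) ℝ} {s : Set ℝ}
  {t : ℝ}

lemma HasEntryDerivWithinAt.mul (hA : HasEntryDerivWithinAt A A' s t)
    (hB : HasEntryDerivWithinAt B B' s t) :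
    HasEntryDerivWithinAt (fun x => A x * B x) (A' * B t + A t * B') s t := by
  intro i j
  simp only [Matrix.add_apply, Matrix.mul_apply, ← Finset.sum_add_distrib]
  exact HasDerivWithinAt.fun_sum fun k _ => (hA i k).mul (hB k j)

lemma HasEntryDerivWithinAt.transpose (hA : HasEntryDerivWithinAt A A' s t) :
    HasEntryDerivWithinAt (fun x => (A x)ᵀ) A'ᵀ s t :=
  fun i j => hA j i

lemma HasEntryDerivWithinAt.sub (hA : HasEntryDerivWithinAt A A' s t)
    (hB : HasEntryDerivWithinAt B B' s t) :
    HasEntryDerivWithinAt (fun x => A x - B x) (A' - B') s t :=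
  fun i j => (hA i j).sub (hB i j)

lemma HasEntryDerivWithinAt.sub_const (hA : HasEntryDerivWithinAt A A' s t)
    (C : Matrix (Fin d) (Fin d) ℝ) :
    HasEntryDerivWithinAt (fun x => A x - C) A' s t :=
  fun i j => (hA i j).sub_const (C i j)

lemma HasEntryDerivWithinAt.frobSq (hA : HasEntryDerivWithinAt A A' s t) :
    HasDerivWithinAt (fun x => frobSq (A x)) (2 * finner (A t) A') s t := by
  simp only [ZAS.frobSq, finner, Finset.mul_sum]
  refine HasDerivWithinAt.fun_sum fun i _ => HasDerivWithinAt.fun_sum fun j _ => ?_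
  exact ((hA i j).fun_pow 2).congr_deriv (by push_cast; ring)

lemma HasEntryDerivWithinAt.seg {W : ℕ → ℝ → Matrix (Fin d) (Fin d) ℝ}
    {W' : ℕ → Matrix (Fin d) (Fin d) ℝ} {n : ℕ}
    (h : ∀ l, 1 ≤ l → l ≤ n → HasEntryDerivWithinAt (W l) (W' l) s t) :
    HasEntryDerivWithinAt (fun x => seg (fun k => W k x) 1 n)
      (∑ l ∈ Finset.Icc 1 n,
        ZAS.seg (fun k => W k t) (l + 1) n * W' l * ZAS.seg (fun k => W k t) 1 (l - 1)) s t := by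
  induction n with
  | zero =>
    intro i j
    simpa [ZAS.seg] using hasDerivWithinAt_const t s ((1 : Matrix (Fin d) (Fin d) ℝ) i j)
  | succ n ih =>
    have key := (h (n + 1) (by omega) le_rfl).mul (ih fun l h1 h2 => h l h1 (by omega))
    simp only [seg_succ _ (Nat.le_add_left 1 n)]
    convert key using 1
    rw [Finset.sum_Icc_succ_top (by omega), add_comm, seg_of_lt _ (Nat.lt_succ_self _),
      Finset.mul_sum, Matrix.one_mul, Nat.add_sub_cancel]
    congr 1
    refine Finset.sum_congr rfl fun l hl => ?_
    rw [seg_succ _ (by have := (Finset.mem_Icc.mp hl).2; omega)]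
    simp only [Matrix.mul_assoc]

/-- A matrix function with zero derivative on `[0, ∞)` is constant there. -/
lemma eq_of_hasEntryDerivWithinAt_zero
    (h : ∀ t ∈ Set.Ici (0 : ℝ), HasEntryDerivWithinAt A 0 (Set.Ici 0) t) (ht : 0 ≤ t) :
    A t = A 0 := by
  ext i j
  refine constant_of_has_deriv_right_zero (f := fun x => A x i j) (a := 0) (b := t)
    (fun x hx => ?_) (fun x hx => ?_) t ⟨ht, le_rfl⟩
  · exact (h x hx.1 i j).continuousWithinAt.mono Set.Icc_subset_Ici_self
  · exact (h x hx.1 i j).mono (Set.Ici_subset_Ici.mpr hx.1)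

/-- A differentiable function with `f' ≤ -c f` on `[0, ∞)` decays exponentially with rate `c`. -/
lemma le_exp_mul_of_hasDerivWithinAt_le {f f' : ℝ → ℝ} {c : ℝ}
    (hf : ∀ t ∈ Set.Ici (0 : ℝ), HasDerivWithinAt f (f' t) (Set.Ici 0) t)
    (hle : ∀ t ∈ Set.Ici (0 : ℝ), f' t ≤ -c * f t) (ht : 0 ≤ t) :
    f t ≤ Real.exp (-c * t) * f 0 := by
  have hg : ∀ x ∈ Set.Ici (0 : ℝ), HasDerivWithinAt (fun x => Real.exp (c * x) * f x)
      (Real.exp (c * x) * (c * f x + f' x)) (Set.Ici 0) x := by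
    intro x hx
    have he : HasDerivWithinAt (fun x => Real.exp (c * x)) (Real.exp (c * x) * (c * 1))
        (Set.Ici 0) x := (((hasDerivAt_id x).const_mul c).exp).hasDerivWithinAt
    exact (he.mul (hf x hx)).congr_deriv (by ring)
  have hanti : AntitoneOn (fun x => Real.exp (c * x) * f x) (Set.Ici 0) := by
    refine antitoneOn_of_hasDerivWithinAt_nonpos (convex_Ici 0)
      (f' := fun x => Real.exp (c * x) * (c * f x + f' x))
      (fun x hx => (hg x hx).continuousWithinAt)
      (fun x hx => (hg x (interior_subset hx)).mono interior_subset) fun x hx => ?_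
    have := hle x (interior_subset hx)
    exact mul_nonpos_of_nonneg_of_nonpos (Real.exp_pos _).le (by linarith)
  have h := hanti (Set.mem_Ici.mpr le_rfl) ht ht
  simp only [mul_zero, Real.exp_zero, one_mul] at h
  calc f t = Real.exp (-c * t) * (Real.exp (c * t) * f t) := by
        rw [← mul_assoc, ← Real.exp_add]
        simp
    _ ≤ _ := by gcongr

end Calculus

section Dynamics

variable {d L : ℕ} {Φ : Matrix (Fin d) (Fin d) ℝ} {W : ℕ → ℝ → Matrix (Fin d) (Fin d) ℝ} {t : ℝ}

lemma Dmat_eq_of_gradient_flow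
    (hdyn : ∀ t ∈ Set.Ici (0 : ℝ), ∀ l, 1 ≤ l → l ≤ L →
      HasEntryDerivWithinAt (W l) (-grad (fun k => W k t) Φ L l) (Set.Ici 0) t)
    {l : ℕ} (hl : 1 ≤ l) (hlL : l < L) (ht : 0 ≤ t) :
    Dmat (fun k => W k t) l = Dmat (fun k => W k 0) l := by
  refine eq_of_hasEntryDerivWithinAt_zero (A := fun x => Dmat (fun k => W k x) l)
    (fun x hx => ?_) ht
  have h1 := hdyn x hx l hl hlL.le
  have h2 := hdyn x hx (l + 1) (by omega) hlL
  have hbal := transpose_mul_grad (fun k => W k x) Φ hl hlL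
  have hbal' := congrArg Matrix.transpose hbal
  simp only [Matrix.transpose_mul, Matrix.transpose_transpose] at hbal'
  have key := (h2.transpose.mul h2).sub (h1.mul h1.transpose)
  rwa [Matrix.transpose_neg, Matrix.transpose_neg, Matrix.neg_mul, Matrix.mul_neg, Matrix.neg_mul,
    Matrix.mul_neg, hbal, hbal', add_comm (-(W l x * _)), sub_self] at key

lemma hasDerivWithinAt_loss {s : Set ℝ}
    (h : ∀ l, 1 ≤ l → l ≤ L →
      HasEntryDerivWithinAt (W l) (-grad (fun k => W k t) Φ L l) s t) :
    HasDerivWithinAt (fun x => loss (fun k => W k x) Φ L)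
      (-∑ l ∈ Finset.Icc 1 L, frobSq (grad (fun k => W k t) Φ L l)) s t := by
  refine (((HasEntryDerivWithinAt.seg h).sub_const Φ).frobSq.div_const 2).congr_deriv ?_
  rw [mul_div_cancel_left₀ _ two_ne_zero, finner_sum, ← Finset.sum_neg_distrib]
  refine Finset.sum_congr rfl fun l _ => ?_
  rw [finner_mul_mul, finner_neg, frobSq_eq_finner]
  rfl

end Dynamics

end ZAS

open ZAS
/-- Theorem 1, continuous-time gradient descent: under continuous-time
gradient descent from the zero-asymmetric initialization, `R(t) ≤ e^{-2t} R(0)` for `t ≥ 0`. -/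
theorem continuous_gd_ZAS_convergence
    (d L : ℕ) (hd : 1 ≤ d) (hL : 1 ≤ L)
    (Φ : Matrix (Fin d) (Fin d) ℝ)
    (W : ℕ → ℝ → Matrix (Fin d) (Fin d) ℝ)
    (hdyn : ∀ t ∈ Set.Ici (0:ℝ), ∀ l, 1 ≤ l → l ≤ L → ∀ i j,
      HasDerivWithinAt (fun s => W l s i j)
        (-((grad (fun k => W k t) Φ L l) i j)) (Set.Ici 0) t)
    (hinit1 : ∀ l, 1 ≤ l → l ≤ L - 1 → W l 0 = 1)
    (hinitL : W L 0 = 0)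
    (t : ℝ) (ht : 0 ≤ t) :
    loss (fun k => W k t) Φ L ≤ Real.exp (-2 * t) * loss (fun k => W k 0) Φ L := by
  have hflow : ∀ t ∈ Set.Ici (0 : ℝ), ∀ l, 1 ≤ l → l ≤ L →
      HasEntryDerivWithinAt (W l) (-grad (fun k => W k t) Φ L l) (Set.Ici 0) t := hdyn
  obtain ⟨n, rfl⟩ := Nat.exists_eq_add_of_le' hL
  refine le_exp_mul_of_hasDerivWithinAt_le (f := fun x => loss (fun k => W k x) Φ (n + 1))
    (fun x hx => hasDerivWithinAt_loss (hflow x hx)) (fun x hx => ?_) ht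
  set V : ℕ → Matrix (Fin d) (Fin d) ℝ := fun k => W k x with hV
  have hD : ∀ l, 1 ≤ l → l < n → Dmat V l = 0 := by
    intro l h1 h2
    rw [hV, Dmat_eq_of_gradient_flow hflow h1 (by omega) hx]
    simp [Dmat, hinit1 l h1 (by omega), hinit1 (l + 1) (by omega) (by omega)]
  have hgram : seg V 1 n * (seg V 1 n)ᵀ = (1 + (V (n + 1))ᵀ * V (n + 1)) ^ n := by
    rw [seg_mul_transpose V n hD]
    rcases Nat.eq_zero_or_pos n with rfl | hn
    · simp
    · have h := Dmat_eq_of_gradient_flow hflow hn (Nat.lt_succ_self n) hx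
      have h0 : Dmat (fun k => W k 0) n = -1 := by
        simp [Dmat, hinitL, hinit1 n hn (by omega)]
      rw [h0] at h
      have h' : (V (n + 1))ᵀ * V (n + 1) - V n * (V n)ᵀ = -1 := h
      congr 1
      rw [eq_add_of_sub_eq h']
      abel
  have hpsd : (seg V 1 n * (seg V 1 n)ᵀ - 1).PosSemidef := by
    rw [hgram]
    refine posSemidef_one_add_pow_sub_one ?_ n
    simpa using Matrix.posSemidef_conjTranspose_mul_self (V (n + 1))
  have hlast : frobSq (seg V 1 (n + 1) - Φ) ≤ frobSq (grad V Φ (n + 1) (n + 1)) := by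
    rw [grad, seg_of_lt V (Nat.lt_succ_self _), Matrix.transpose_one, Matrix.one_mul,
      Nat.add_sub_cancel]
    exact frobSq_le_frobSq_mul_transpose hpsd _
  have hsum := Finset.single_le_sum (f := fun l => frobSq (grad V Φ (n + 1) l))
    (fun l _ => frobSq_nonneg _) (Finset.mem_Icc.mpr ⟨hL, le_rfl⟩)
  simp only [loss]
  linarith
end

section
/- Let d ≥ 1, L ≥ 2 and W_1,…,W_L ∈ ℝ^{d×d}. If W_l W_lᵀ = W_{l+1}ᵀ W_{l+1} for all l = 1,…,L−2 and W_{L−1} W_{L−1}ᵀ = I + W_Lᵀ W_L, then W_{L−1:1} W_{L−1:1}ᵀ = (I + W_Lᵀ W_L)^{L−1}. -/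
open Matrix

open ZAS

/-- If `W_l W_lᵀ = W_{l+1}ᵀ W_{l+1}` for `1 ≤ l ≤ k`, then
`W_{k+1:1} W_{k+1:1}ᵀ = (W_{k+1} W_{k+1}ᵀ)^{k+1}`. -/
theorem ZAS.seg_mul_transpose_eq_pow {d : ℕ} (W : ℕ → Matrix (Fin d) (Fin d) ℝ) (k : ℕ)
    (hbal : ∀ l, 1 ≤ l → l ≤ k → W l * (W l)ᵀ = (W (l+1))ᵀ * W (l+1)) :
    seg W 1 (k+1) * (seg W 1 (k+1))ᵀ = (W (k+1) * (W (k+1))ᵀ) ^ (k+1) := by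
  induction k with
  | zero => simp [seg]
  | succ k ih =>
    have hsemi : SemiconjBy (W (k+2)) ((W (k+2))ᵀ * W (k+2)) (W (k+2) * (W (k+2))ᵀ) :=
      (Matrix.mul_assoc _ _ _).symm
    have hseg : seg W 1 (k+2) = W (k+2) * seg W 1 (k+1) := by
      rw [seg, if_neg (by omega)]
    calc seg W 1 (k+2) * (seg W 1 (k+2))ᵀ
        = W (k+2) * (seg W 1 (k+1) * (seg W 1 (k+1))ᵀ) * (W (k+2))ᵀ := by
          simp only [hseg, Matrix.transpose_mul, Matrix.mul_assoc]
      _ = W (k+2) * ((W (k+2))ᵀ * W (k+2)) ^ (k+1) * (W (k+2))ᵀ := by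
          rw [ih fun l h₁ h₂ => hbal l h₁ (by omega), hbal (k+1) (by omega) le_rfl]
      _ = (W (k+2) * (W (k+2))ᵀ) ^ (k+2) := by
          rw [(hsemi.pow_right (k+1)).eq, Matrix.mul_assoc, ← pow_succ]

/-- under exact balancedness (`W_l W_lᵀ = W_{l+1}ᵀ W_{l+1}` for `l ≤ L-2` and
`W_{L-1} W_{L-1}ᵀ = I + W_Lᵀ W_L`), one has `W_{L-1:1} W_{L-1:1}ᵀ = (I + W_Lᵀ W_L)^{L-1}`. -/
theorem balanced_product_identity
    (d L : ℕ) (hd : 1 ≤ d) (hL : 2 ≤ L)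
    (W : ℕ → Matrix (Fin d) (Fin d) ℝ)
    (hbal : ∀ l, 1 ≤ l → l ≤ L - 2 → W l * (W l)ᵀ = (W (l+1))ᵀ * W (l+1))
    (hlast : W (L-1) * (W (L-1))ᵀ = 1 + (W L)ᵀ * W L) :
    seg W 1 (L-1) * (seg W 1 (L-1))ᵀ = (1 + (W L)ᵀ * W L) ^ (L-1) := by
  obtain ⟨k, rfl⟩ : ∃ k, L = k + 2 := ⟨L - 2, by omega⟩
  rw [← hlast]
  exact seg_mul_transpose_eq_pow W k hbal
end

section
/- Let d ≥ 1, L ≥ 2, Φ ∈ ℝ^{d×d}, φ > 0, and W_1,…,W_L ∈ ℝ^{d×d}. Assume: ‖W_l‖₂ ≤ α for l = 1,…,L−1 with 1 ≤ α^{2(L−1)} < L φ²; ‖D_l‖₂ ≤ δ for l = 1,…,L−2 with δ ≤ (2 L³ φ²)^{−1}; and ‖I + D_{L−1}‖₂ ≤ ε with ε ≤ (4 L²)^{−1}. Then ‖∇_L R‖_F² ≥ R. -/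
open Matrix

open ZAS

namespace ZAS

/-- Telescoping bound for the difference of two powers in a normed ring. -/
lemma norm_pow_succ_sub_pow_succ_le {R : Type*} [NormedRing R] {a b : R} {M : ℝ}
    (ha : ‖a‖ ≤ M) (hb : ‖b‖ ≤ M) (k : ℕ) :
    ‖a ^ (k + 1) - b ^ (k + 1)‖ ≤ (k + 1) * M ^ k * ‖a - b‖ := by
  have hM : 0 ≤ M := (norm_nonneg a).trans ha
  induction k with
  | zero => simp
  | succ k ih =>
    have hsplit : a ^ (k + 1 + 1) - b ^ (k + 1 + 1)
        = a ^ (k + 1) * (a - b) + (a ^ (k + 1) - b ^ (k + 1)) * b := by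
      rw [pow_succ a (k + 1), pow_succ b (k + 1)]
      noncomm_ring
    have hpow : ‖a ^ (k + 1)‖ ≤ M ^ (k + 1) :=
      (norm_pow_le' a k.succ_pos).trans (pow_le_pow_left₀ (norm_nonneg a) ha _)
    calc ‖a ^ (k + 1 + 1) - b ^ (k + 1 + 1)‖
        ≤ ‖a ^ (k + 1)‖ * ‖a - b‖ + ‖a ^ (k + 1) - b ^ (k + 1)‖ * ‖b‖ := by
          rw [hsplit]
          exact (norm_add_le _ _).trans (add_le_add (norm_mul_le _ _) (norm_mul_le _ _))
      _ ≤ M ^ (k + 1) * ‖a - b‖ + ((k + 1) * M ^ k * ‖a - b‖) * M := by gcongr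
      _ = ((k + 1 : ℕ) + 1) * M ^ (k + 1) * ‖a - b‖ := by push_cast; ring

/-- For an approximately balanced sequence, the Gram matrix of the partial product is close to a
power of the Gram matrix of the last factor. -/
lemma norm_mul_star_sub_pow_le {R : Type*} [NormedRing R] [StarRing R] [NormedStarGroup R]
    {T P : ℕ → R} (hP0 : P 0 = 1) (hP : ∀ n, P (n + 1) = T (n + 1) * P n) {α δ : ℝ} (n : ℕ)
    (hT : ∀ l, 1 ≤ l → l ≤ n + 1 → ‖T l‖ ≤ α)
    (hD : ∀ l, 1 ≤ l → l ≤ n → ‖star (T (l + 1)) * T (l + 1) - T l * star (T l)‖ ≤ δ) :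
    ‖P (n + 1) * star (P (n + 1)) - (T (n + 1) * star (T (n + 1))) ^ (n + 1)‖
      ≤ δ * α ^ (2 * n) * ((n + 1) * n / 2) := by
  induction n with
  | zero => simp [hP, hP0]
  | succ n ih =>
    have hα : 0 ≤ α := (norm_nonneg _).trans (hT 1 le_rfl (by omega))
    specialize ih (fun l h₁ h₂ => hT l h₁ (by omega)) (fun l h₁ h₂ => hD l h₁ (by omega))
    set A := T (n + 1 + 1) with hA
    set B := T (n + 1) with hB
    set Q := P (n + 1) with hQ
    have hAn : ‖A‖ ≤ α := hT _ (by omega) le_rfl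
    have hBn : ‖B‖ ≤ α := hT _ (by omega) (by omega)
    have hAA : ‖star A * A‖ ≤ α ^ 2 := by
      calc ‖star A * A‖ ≤ ‖star A‖ * ‖A‖ := norm_mul_le _ _
        _ ≤ α * α := by rw [norm_star]; gcongr
        _ = α ^ 2 := by ring
    have hBB : ‖B * star B‖ ≤ α ^ 2 := by
      calc ‖B * star B‖ ≤ ‖B‖ * ‖star B‖ := norm_mul_le _ _
        _ ≤ α * α := by rw [norm_star]; gcongr
        _ = α ^ 2 := by ring
    have hpow : (A * star A) ^ (n + 1 + 1) = A * (star A * A) ^ (n + 1) * star A := by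
      rw [pow_succ, ← mul_assoc, mul_pow_mul]
    have hsplit : P (n + 1 + 1) * star (P (n + 1 + 1)) - (A * star A) ^ (n + 1 + 1)
        = A * ((Q * star Q - (B * star B) ^ (n + 1))
            - ((star A * A) ^ (n + 1) - (B * star B) ^ (n + 1))) * star A := by
      rw [hpow, hP (n + 1), star_mul]
      noncomm_ring
    have hdiff : ‖(star A * A) ^ (n + 1) - (B * star B) ^ (n + 1)‖
        ≤ (n + 1) * (α ^ 2) ^ n * δ :=
      (norm_pow_succ_sub_pow_succ_le hAA hBB n).trans
        (mul_le_mul_of_nonneg_left (hD (n + 1) (by omega) le_rfl) (by positivity))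
    rw [hsplit]
    set U := Q * star Q - (B * star B) ^ (n + 1)
    set V := (star A * A) ^ (n + 1) - (B * star B) ^ (n + 1)
    have hUV : ‖U - V‖ ≤ δ * α ^ (2 * n) * ((n + 1) * n / 2) + (n + 1) * (α ^ 2) ^ n * δ :=
      (norm_sub_le U V).trans (add_le_add ih hdiff)
    calc ‖A * (U - V) * star A‖ ≤ ‖A‖ * ‖U - V‖ * ‖star A‖ := norm_mul₃_le
      _ ≤ α * (δ * α ^ (2 * n) * ((n + 1) * n / 2) + (n + 1) * (α ^ 2) ^ n * δ) * α := by
          rw [norm_star]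
          have := (norm_nonneg _).trans hUV
          gcongr
      _ = δ * α ^ (2 * (n + 1)) * (((n + 1 : ℕ) + 1) * (n + 1 : ℕ) / 2) := by
          push_cast; ring

section Operators

variable {E : Type*} [NormedAddCommGroup E] [InnerProductSpace ℝ E]

open scoped RealInnerProductSpace

lemma abs_inner_apply_self_le {S : E →L[ℝ] E} {c : ℝ} (hS : ‖S‖ ≤ c) (x : E) :
    |⟪S x, x⟫| ≤ c * ‖x‖ ^ 2 :=
  calc |⟪S x, x⟫| ≤ ‖S x‖ * ‖x‖ := abs_real_inner_le_norm _ _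
    _ ≤ (c * ‖x‖) * ‖x‖ := by gcongr; exact S.le_of_opNorm_le hS x
    _ = c * ‖x‖ ^ 2 := by ring

/-- A quadratic lower bound of a symmetric operator passes to its powers. -/
lemma pow_mul_norm_sq_le_inner_pow_apply {S : E →L[ℝ] E}
    (hS : (S : E →ₗ[ℝ] E).IsSymmetric) {c : ℝ} (hc : 0 ≤ c)
    (h : ∀ x, c * ‖x‖ ^ 2 ≤ ⟪S x, x⟫) (n : ℕ) (x : E) :
    c ^ n * ‖x‖ ^ 2 ≤ ⟪(S ^ n) x, x⟫ := by
  induction n using Nat.twoStepInduction generalizing x with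
  | zero => simp
  | one => simpa using h x
  | more n ih _ =>
    have hnorm : c * ‖x‖ ≤ ‖S x‖ := by
      rcases (norm_nonneg x).eq_or_lt with hx | hx
      · simp [← hx]
      · have := (h x).trans (real_inner_le_norm (S x) x)
        nlinarith
    have hstep : ⟪(S ^ (n + 2)) x, x⟫ = ⟪(S ^ n) (S x), S x⟫ := by
      have : S ^ (n + 2) = S * S ^ n * S := by rw [← pow_succ', ← pow_succ]
      rw [this]
      exact hS _ _
    calc c ^ (n + 2) * ‖x‖ ^ 2 = c ^ n * (c * ‖x‖) ^ 2 := by ring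
      _ ≤ c ^ n * ‖S x‖ ^ 2 := by gcongr
      _ ≤ ⟪(S ^ n) (S x), S x⟫ := ih (S x)
      _ = ⟪(S ^ (n + 2)) x, x⟫ := hstep.symm

/-- In finite dimension, a lower bound for `P P*` is also one for `P* P`. -/
lemma mul_norm_sq_le_norm_apply_sq [FiniteDimensional ℝ E] {P : E →L[ℝ] E} {c : ℝ} (hc : 0 < c)
    (h : ∀ x, c * ‖x‖ ^ 2 ≤ ‖star P x‖ ^ 2) (x : E) : c * ‖x‖ ^ 2 ≤ ‖P x‖ ^ 2 := by
  have hinj : Function.Injective (star P : E →L[ℝ] E) := by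
    refine (injective_iff_map_eq_zero _).2 fun y hy => ?_
    have hy' := h y
    rw [hy, norm_zero] at hy'
    by_contra hne
    have : 0 < c * ‖y‖ ^ 2 := mul_pos hc (pow_pos (norm_pos_iff.2 hne) 2)
    linarith
  obtain ⟨y, rfl⟩ := (LinearMap.injective_iff_surjective
    (f := ((star P : E →L[ℝ] E) : E →ₗ[ℝ] E))).1 hinj x
  change c * ‖star P y‖ ^ 2 ≤ ‖P (star P y)‖ ^ 2
  set z := star P y with hz
  have hle : ‖z‖ ^ 2 ≤ ‖y‖ * ‖P z‖ := by
    rw [← real_inner_self_eq_norm_sq]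
    nth_rewrite 1 [hz]
    rw [ContinuousLinearMap.star_eq_adjoint, ContinuousLinearMap.adjoint_inner_left]
    exact real_inner_le_norm _ _
  have hy := h y
  rcases (norm_nonneg z).eq_or_lt with hz0 | hz0
  · simp [← hz0]
  · have h4 : (‖z‖ ^ 2) ^ 2 ≤ (‖y‖ * ‖P z‖) ^ 2 := by gcongr
    have h5 : c * ‖y‖ ^ 2 * ‖P z‖ ^ 2 ≤ ‖z‖ ^ 2 * ‖P z‖ ^ 2 := by gcongr
    have h6 : ‖z‖ ^ 2 * (c * ‖z‖ ^ 2) ≤ ‖z‖ ^ 2 * ‖P z‖ ^ 2 := by nlinarith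
    exact le_of_mul_le_mul_left h6 (by positivity)

end Operators

lemma frobSq_eq_sum_norm_sq {m n : ℕ} (A : Matrix (Fin m) (Fin n) ℝ) :
    frobSq A = ∑ i, ‖(WithLp.toLp 2 (A i) : EuclideanSpace ℝ (Fin n))‖ ^ 2 := by
  simp [frobSq, EuclideanSpace.norm_sq_eq]

lemma mul_frobSq_le_frobSq_mul_transpose {m d : ℕ} {P : Matrix (Fin d) (Fin d) ℝ} {c : ℝ}
    (h : ∀ x, c * ‖x‖ ^ 2 ≤ ‖Matrix.toEuclideanCLM (𝕜 := ℝ) P x‖ ^ 2)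
    (A : Matrix (Fin m) (Fin d) ℝ) : c * frobSq A ≤ frobSq (A * Pᵀ) := by
  rw [frobSq_eq_sum_norm_sq, frobSq_eq_sum_norm_sq, Finset.mul_sum]
  refine Finset.sum_le_sum fun i _ => ?_
  have hrow : (A * Pᵀ) i = P *ᵥ A i := by
    ext j
    simp [Matrix.mul_apply, Matrix.mulVec, dotProduct, mul_comm]
  rw [hrow]
  exact h (WithLp.toLp 2 (A i))

/-- The product of the first `L - 1` layers is well conditioned. -/
lemma half_norm_sq_le_norm_seg_apply_sq {d n : ℕ} {W : ℕ → Matrix (Fin d) (Fin d) ℝ}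
    {α δ ε : ℝ} (hW : ∀ l, 1 ≤ l → l ≤ n + 1 → spec (W l) ≤ α)
    (hD : ∀ l, 1 ≤ l → l ≤ n → spec (Dmat W l) ≤ δ)
    (hDL : spec (1 + Dmat W (n + 1)) ≤ ε) (hε : (n + 1) * ε ≤ 1 / 4)
    (hδ : δ * α ^ (2 * n) * ((n + 1) * n / 2) ≤ 1 / 4) (x : EuclideanSpace ℝ (Fin d)) :
    1 / 2 * ‖x‖ ^ 2 ≤ ‖Matrix.toEuclideanCLM (𝕜 := ℝ) (seg W 1 (n + 1)) x‖ ^ 2 := by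
  set τ := Matrix.toEuclideanCLM (n := Fin d) (𝕜 := ℝ) with hτ
  have hstar : ∀ A, τ Aᵀ = star (τ A) := fun A => by
    rw [← map_star, Matrix.star_eq_conjTranspose, Matrix.conjTranspose_eq_transpose_of_trivial]
  have hDmat : ∀ l, τ (Dmat W l)
      = star (τ (W (l + 1))) * τ (W (l + 1)) - τ (W l) * star (τ (W l)) := fun l => by
    simp only [Dmat, map_sub, map_mul, hstar]
  have hmain := norm_mul_star_sub_pow_le (T := fun l => τ (W l)) (P := fun l => τ (seg W 1 l))
    (by simp [seg]) (fun l => by simp [seg]) n hW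
    (fun l h₁ h₂ => by have := hD l h₁ h₂; rwa [spec, ← hτ, hDmat] at this)
  beta_reduce at hmain
  set P := τ (seg W 1 (n + 1))
  set A := τ (W (n + 1))
  set B := τ (W (n + 1 + 1))
  have hε0 : 0 ≤ ε := (norm_nonneg _).trans hDL
  have hε1 : ε ≤ 1 := by nlinarith [(Nat.cast_nonneg n : (0 : ℝ) ≤ n)]
  have hstarinner : ∀ (S : EuclideanSpace ℝ (Fin d) →L[ℝ] EuclideanSpace ℝ (Fin d)) y,
      inner ℝ ((S * star S) y) y = ‖star S y‖ ^ 2 := fun S y => by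
    rw [← real_inner_self_eq_norm_sq, ContinuousLinearMap.star_eq_adjoint,
      ContinuousLinearMap.adjoint_inner_left, real_inner_comm]
    rfl
  have hlow : ∀ y, (1 - ε) * ‖y‖ ^ 2 ≤ inner ℝ ((A * star A) y) y := fun y => by
    have hb := abs_inner_apply_self_le hDL y
    have hsplit : A * star A = 1 + star B * B - τ (1 + Dmat W (n + 1)) := by
      rw [map_add, map_one, hDmat]; abel
    have hB := hstarinner (star B) y
    rw [star_star] at hB
    rw [hsplit, _root_.sub_apply, _root_.add_apply, inner_sub_left,
      inner_add_left, hB, one_apply_eq_self, real_inner_self_eq_norm_sq]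
    nlinarith [(abs_le.1 hb).2, sq_nonneg ‖B y‖]
  have hsymm : ((A * star A : EuclideanSpace ℝ (Fin d) →L[ℝ] EuclideanSpace ℝ (Fin d)) :
      EuclideanSpace ℝ (Fin d) →ₗ[ℝ] EuclideanSpace ℝ (Fin d)).IsSymmetric :=
    (IsSelfAdjoint.mul_star_self A).isSymmetric
  have hbern : 3 / 4 ≤ (1 - ε) ^ (n + 1) := by
    have := one_add_mul_le_pow (a := -ε) (by linarith) (n + 1)
    push_cast at this
    rw [← sub_eq_add_neg] at this
    linarith
  refine mul_norm_sq_le_norm_apply_sq (by norm_num) (fun y => ?_) x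
  have hpow := pow_mul_norm_sq_le_inner_pow_apply hsymm (sub_nonneg.2 hε1) hlow (n + 1) y
  have herr := abs_inner_apply_self_le (hmain.trans hδ) y
  rw [_root_.sub_apply, inner_sub_left, hstarinner] at herr
  nlinarith [(abs_le.1 herr).1, mul_le_mul_of_nonneg_right hbern (sq_nonneg ‖y‖)]

end ZAS

/-- Lemma A.2: under approximate balancedness, `‖∇_L R‖_F² ≥ R`. -/
theorem approx_balanced_last_layer_gradient_bound
    (d L : ℕ) (hd : 1 ≤ d) (hL : 2 ≤ L)
    (Φ : Matrix (Fin d) (Fin d) ℝ) (φ : ℝ) (hφ : 0 < φ)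
    (W : ℕ → Matrix (Fin d) (Fin d) ℝ) (α δ ε : ℝ)
    (hW : ∀ l, 1 ≤ l → l ≤ L - 1 → spec (W l) ≤ α)
    (hα1 : 1 ≤ α^(2*(L-1))) (hα2 : α^(2*(L-1)) < L * φ^2)
    (hD : ∀ l, 1 ≤ l → l ≤ L - 2 → spec (Dmat W l) ≤ δ)
    (hδ : δ ≤ (2 * (L:ℝ)^3 * φ^2)⁻¹)
    (hDL : spec (1 + Dmat W (L-1)) ≤ ε)
    (hε : ε ≤ (4 * (L:ℝ)^2)⁻¹) :
    loss W Φ L ≤ frobSq (grad W Φ L L) := by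
  obtain ⟨n, rfl⟩ : ∃ n, L = n + 2 := ⟨L - 2, by omega⟩
  simp only [show n + 2 - 1 = n + 1 by omega, Nat.add_sub_cancel] at *
  have hgrad : grad W Φ (n + 2) (n + 2) = (seg W 1 (n + 2) - Φ) * (seg W 1 (n + 1))ᵀ := by
    simp [grad, show seg W (n + 2 + 1) (n + 2) = 1 by simp [seg]]
  have hn : (0 : ℝ) ≤ n := Nat.cast_nonneg n
  push_cast at hα2 hδ hε
  have hα0 : 0 ≤ α := (norm_nonneg _).trans (hW 1 le_rfl (by omega))
  have hα : 1 ≤ α := by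
    by_contra! hlt
    exact absurd hα1 (not_le.2 (pow_lt_one₀ hα0 hlt (by omega)))
  have hεn : (n + 1 : ℝ) * ε ≤ 1 / 4 := by
    calc (n + 1 : ℝ) * ε ≤ (n + 1) * (4 * ((n : ℝ) + 2) ^ 2)⁻¹ := by gcongr
      _ ≤ 1 / 4 := by
        rw [← div_eq_mul_inv, div_le_div_iff₀ (by positivity) (by norm_num)]
        nlinarith
  have hδn : δ * α ^ (2 * n) * ((n + 1) * n / 2) ≤ 1 / 4 := by
    have hαn : α ^ (2 * n) ≤ (n + 2) * φ ^ 2 :=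
      (pow_le_pow_right₀ hα (by omega)).trans hα2.le
    calc δ * α ^ (2 * n) * ((n + 1) * n / 2)
        ≤ (2 * ((n : ℝ) + 2) ^ 3 * φ ^ 2)⁻¹ * α ^ (2 * n) * ((n + 1) * n / 2) := by gcongr
      _ ≤ (2 * ((n : ℝ) + 2) ^ 3 * φ ^ 2)⁻¹ * ((n + 2) * φ ^ 2) * ((n + 1) * n / 2) := by gcongr
      _ = (n + 1) * n / (4 * ((n : ℝ) + 2) ^ 2) := by field_simp; ring
      _ ≤ 1 / 4 := by
        rw [div_le_div_iff₀ (by positivity) (by norm_num)]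
        nlinarith
  have hbound := mul_frobSq_le_frobSq_mul_transpose
    (half_norm_sq_le_norm_seg_apply_sq hW hD hDL hεn hδn) (seg W 1 (n + 2) - Φ)
  rw [hgrad, loss]
  linarith
end

section
/- Let d ≥ 1, L ≥ 2 and W_1,…,W_L ∈ ℝ^{d×d}. Set α = max{max_{1≤l≤L−1} ‖W_l‖₂, 1}, β = ‖W_L‖₂, and φ = max{‖W_{L:1}‖₂, e/√L, 1}. Assume ‖D_l‖₂ ≤ δ for l = 1,…,L−2 with δ ≤ (2 L³ φ²)^{−1}, and ‖I + D_{L−1}‖₂ ≤ ε with ε ≤ (4 L²)^{−1}. Then α^{2(L−1)} < L φ² and α^{2(L−1)} β² < 2 φ². -/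
open Matrix

open ZAS
open ContinuousLinearMap

section Operator

variable {E : Type*} [NormedAddCommGroup E] [InnerProductSpace ℝ E]

theorem inner_apply_le_of_norm_le {M : E →L[ℝ] E} {δ : ℝ} (h : ‖M‖ ≤ δ) (x : E) :
    inner ℝ (M x) x ≤ δ * ‖x‖ ^ 2 := by
  calc inner ℝ (M x) x ≤ ‖M x‖ * ‖x‖ := real_inner_le_norm _ _
    _ ≤ δ * ‖x‖ * ‖x‖ := by gcongr; exact M.le_of_opNorm_le h x
    _ = δ * ‖x‖ ^ 2 := by ring

theorem exists_norm_le_one_norm_apply_eq [FiniteDimensional ℝ E] (A : E →L[ℝ] E) :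
    ∃ u : E, ‖u‖ ≤ 1 ∧ ‖A u‖ = ‖A‖ := by
  obtain ⟨u, hu, hmax⟩ := (isCompact_closedBall (0 : E) 1).exists_isMaxOn
    ⟨0, by simp⟩ (f := fun x => ‖A x‖) (by fun_prop)
  have hu1 : ‖u‖ ≤ 1 := by simpa using hu
  refine ⟨u, hu1, le_antisymm (A.unit_le_opNorm u hu1) ?_⟩
  by_contra! hlt
  obtain ⟨x, hx, hlx⟩ := A.exists_lt_apply_of_lt_opNorm hlt
  have := hmax (show x ∈ Metric.closedBall (0 : E) 1 by simpa using hx.le)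
  simp only [Set.mem_ofPred_eq] at this
  linarith

variable [CompleteSpace E]

/-- The ratios of squared norms along an orbit of adjoints decrease by at most the balancedness
defect at each step. -/
theorem ratio_lower_bound_step (A B : E →L[ℝ] E) (w : E) {c g : ℝ} (hc : 0 ≤ c)
    (hw : c * ‖w‖ ^ 2 ≤ ‖adjoint A w‖ ^ 2)
    (hg : ∀ x, ‖A x‖ ^ 2 - ‖adjoint B x‖ ^ 2 ≤ g * ‖x‖ ^ 2) :
    (c - g) * ‖adjoint A w‖ ^ 2 ≤ ‖adjoint B (adjoint A w)‖ ^ 2 := by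
  have hgx := hg (adjoint A w)
  set x := adjoint A w with hx
  have hcs : ‖x‖ ^ 2 ≤ ‖w‖ * ‖A x‖ := by
    calc ‖x‖ ^ 2 = inner ℝ w (A x) := by
          rw [← real_inner_self_eq_norm_sq, ← adjoint_inner_left A]
      _ ≤ ‖w‖ * ‖A x‖ := real_inner_le_norm _ _
  suffices h : c * ‖x‖ ^ 2 ≤ ‖A x‖ ^ 2 by linarith
  rcases (sq_nonneg ‖x‖).eq_or_lt with h0 | h0
  · rw [← h0, mul_zero]
    positivity
  · refine le_of_mul_le_mul_right ?_ h0
    calc c * ‖x‖ ^ 2 * ‖x‖ ^ 2 = c * (‖x‖ ^ 2) ^ 2 := by ring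
      _ ≤ c * (‖w‖ * ‖A x‖) ^ 2 := by gcongr
      _ = c * ‖w‖ ^ 2 * ‖A x‖ ^ 2 := by ring
      _ ≤ ‖x‖ ^ 2 * ‖A x‖ ^ 2 := by gcongr
      _ = ‖A x‖ ^ 2 * ‖x‖ ^ 2 := by ring

theorem norm_sq_sub_norm_adjoint_sq (A B : E →L[ℝ] E) (x : E) :
    ‖A x‖ ^ 2 - ‖adjoint B x‖ ^ 2 = inner ℝ ((star A * A - B * star B) x) x := by
  rw [star_eq_adjoint, star_eq_adjoint, _root_.sub_apply, inner_sub_left,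
    mul_apply_eq_comp, mul_apply_eq_comp, adjoint_inner_left,
    ← adjoint_inner_right B, real_inner_self_eq_norm_sq, real_inner_self_eq_norm_sq]

theorem norm_mul_star_self_eq_sq (A : E →L[ℝ] E) : ‖A * star A‖ = ‖A‖ ^ 2 := by
  rw [sq]
  exact CStarRing.norm_self_mul_star

theorem norm_star_mul_self_eq_sq (A : E →L[ℝ] E) : ‖star A * A‖ = ‖A‖ ^ 2 := by
  rw [sq]
  exact CStarRing.norm_star_mul_self

/-- The orbit of `u` under the adjoints of `V 0, V 1, …`. -/
noncomputable def adjointOrbit (V : ℕ → E →L[ℝ] E) (u : E) : ℕ → E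
  | 0 => u
  | j + 1 => adjoint (V j) (adjointOrbit V u j)

theorem adjointOrbit_ratio (V : ℕ → E →L[ℝ] E) {n : ℕ} {δ ε : ℝ} (hδ : 0 ≤ δ)
    (hsmall : ε + n * δ ≤ 1)
    (h0 : ‖1 + (star (V 0) * V 0 - V 1 * star (V 1))‖ ≤ ε)
    (hV : ∀ j, 1 ≤ j → j < n → ‖star (V j) * V j - V (j + 1) * star (V (j + 1))‖ ≤ δ)
    {u : E} (hu : ‖u‖ ≤ 1) (hu' : ‖adjoint (V 0) u‖ = ‖V 0‖) :
    ∀ j < n, (1 + ‖V 0‖ ^ 2 - ε - j * δ) * ‖adjointOrbit V u (j + 1)‖ ^ 2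
      ≤ ‖adjointOrbit V u (j + 2)‖ ^ 2 := by
  intro j
  induction j with
  | zero =>
    intro _
    have := ratio_lower_bound_step (V 0) (V 1) u (c := ‖V 0‖ ^ 2) (g := ε - 1) (by positivity)
      (by rw [hu']; exact mul_le_of_le_one_right (by positivity) (pow_le_one₀ (norm_nonneg _) hu))
      (fun x => by
        have := inner_apply_le_of_norm_le h0 x
        rw [_root_.add_apply, inner_add_left, one_apply_eq_self, real_inner_self_eq_norm_sq,
          ← norm_sq_sub_norm_adjoint_sq] at this
        linarith)
    simp only [adjointOrbit]
    refine le_of_eq_of_le ?_ this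
    push_cast
    ring
  | succ j ih =>
    intro hj
    have hjn : (j : ℝ) * δ ≤ n * δ := by gcongr; omega
    have := ratio_lower_bound_step (V (j + 1)) (V (j + 2)) (adjointOrbit V u (j + 1))
      (by nlinarith [sq_nonneg ‖V 0‖]) (ih (by omega)) (g := δ) (fun x => by
        rw [norm_sq_sub_norm_adjoint_sq]
        exact inner_apply_le_of_norm_le (hV (j + 1) (by omega) hj) x)
    refine le_of_eq_of_le ?_ this
    push_cast
    simp only [adjointOrbit]
    ring

theorem adjointOrbit_lower_bound (V : ℕ → E →L[ℝ] E) {n : ℕ} {δ ε : ℝ} (hδ : 0 ≤ δ)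
    (hsmall : ε + n * δ ≤ 1)
    (h0 : ‖1 + (star (V 0) * V 0 - V 1 * star (V 1))‖ ≤ ε)
    (hV : ∀ j, 1 ≤ j → j < n → ‖star (V j) * V j - V (j + 1) * star (V (j + 1))‖ ≤ δ)
    {u : E} (hu : ‖u‖ ≤ 1) (hu' : ‖adjoint (V 0) u‖ = ‖V 0‖) :
    ‖V 0‖ ^ 2 * (1 + ‖V 0‖ ^ 2 - ε - n * δ) ^ n ≤ ‖adjointOrbit V u (n + 1)‖ ^ 2 := by
  have hratio := adjointOrbit_ratio V hδ hsmall h0 hV hu hu'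
  have hc : 0 ≤ 1 + ‖V 0‖ ^ 2 - ε - n * δ := by nlinarith [sq_nonneg ‖V 0‖]
  have key : ∀ j ≤ n, ‖V 0‖ ^ 2 * (1 + ‖V 0‖ ^ 2 - ε - n * δ) ^ j
      ≤ ‖adjointOrbit V u (j + 1)‖ ^ 2 := by
    intro j
    induction j with
    | zero => intro _; simp [adjointOrbit, hu']
    | succ j ih =>
      intro hj
      have hjn : (j : ℝ) * δ ≤ n * δ := by gcongr; omega
      calc ‖V 0‖ ^ 2 * (1 + ‖V 0‖ ^ 2 - ε - n * δ) ^ (j + 1)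
          = (1 + ‖V 0‖ ^ 2 - ε - n * δ) *
              (‖V 0‖ ^ 2 * (1 + ‖V 0‖ ^ 2 - ε - n * δ) ^ j) := by ring
        _ ≤ (1 + ‖V 0‖ ^ 2 - ε - n * δ) * ‖adjointOrbit V u (j + 1)‖ ^ 2 := by
          gcongr; exact ih (by omega)
        _ ≤ (1 + ‖V 0‖ ^ 2 - ε - j * δ) * ‖adjointOrbit V u (j + 1)‖ ^ 2 := by gcongr
        _ ≤ _ := hratio j hj
  exact key n le_rfl

theorem norm_sq_upper_bound (V : ℕ → E →L[ℝ] E) {n : ℕ} {δ ε : ℝ}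
    (h0 : ‖1 + (star (V 0) * V 0 - V 1 * star (V 1))‖ ≤ ε)
    (hV : ∀ j, 1 ≤ j → j < n → ‖star (V j) * V j - V (j + 1) * star (V (j + 1))‖ ≤ δ) :
    ∀ j < n, ‖V (j + 1)‖ ^ 2 ≤ 1 + ‖V 0‖ ^ 2 + ε + j * δ := by
  have hone : ‖(1 : E →L[ℝ] E)‖ ≤ 1 := norm_id_le
  intro j
  induction j with
  | zero =>
    intro _
    have h : V 1 * star (V 1) = 1 + star (V 0) * V 0
        - (1 + (star (V 0) * V 0 - V 1 * star (V 1))) := by abel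
    have hn := (norm_sub_le (1 + star (V 0) * V 0)
      (1 + (star (V 0) * V 0 - V 1 * star (V 1)))).trans
      (add_le_add_left (norm_add_le _ _) _)
    rw [← h, norm_mul_star_self_eq_sq, norm_star_mul_self_eq_sq] at hn
    rw [Nat.cast_zero, zero_mul, zero_add]
    linarith
  | succ j ih =>
    intro hj
    have h : V (j + 2) * star (V (j + 2)) = star (V (j + 1)) * V (j + 1)
        - (star (V (j + 1)) * V (j + 1) - V (j + 2) * star (V (j + 2))) := by abel
    have hn := norm_sub_le (star (V (j + 1)) * V (j + 1))
      (star (V (j + 1)) * V (j + 1) - V (j + 2) * star (V (j + 2)))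
    rw [← h, norm_mul_star_self_eq_sq, norm_star_mul_self_eq_sq] at hn
    have := hV (j + 1) (by omega) hj
    have := ih (by omega)
    push_cast
    linarith

end Operator

/-- The scalar part of the argument: `q`, `b`, `F` stand for `α²`, `β²`, `φ²`. -/
theorem scalar_weight_bounds {L : ℕ} (hL : 2 ≤ L) {q b F e : ℝ} (hq : 1 ≤ q) (hb : 0 ≤ b)
    (hF : 0 < F) (hFe : Real.exp 2 ≤ L * F) (he0 : 0 ≤ e) (he : e ≤ 3 / (4 * (L : ℝ) ^ 2))
    (hqb : q ≤ 1 + b + e) (hlow : b * (1 + b - e) ^ (L - 1) ≤ F) :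
    q ^ (L - 1) < L * F ∧ q ^ (L - 1) * b < 2 * F := by
  have hL2 : (2 : ℝ) ≤ L := by exact_mod_cast hL
  have hn : ((L - 1 : ℕ) : ℝ) = L - 1 := by rw [Nat.cast_sub (by omega)]; simp
  have heL : e * (4 * (L : ℝ) ^ 2) ≤ 3 := (le_div_iff₀ (by positivity)).1 he
  have he4 : e ≤ 3 / 16 := by nlinarith [mul_le_mul_of_nonneg_left (by nlinarith : (4 : ℝ) ≤ L ^ 2) he0]
  have hLe : ((L : ℝ) - 1) * e ≤ 3 / 16 := by nlinarith [sq_nonneg ((L : ℝ) - 2)]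
  have hqpos : 0 < q ^ (L - 1) := by positivity
  have hmain : 5 / 8 * (q ^ (L - 1) * b) ≤ F := by
    have hbern : 5 / 8 ≤ (1 - 2 * e) ^ (L - 1) := by
      have := one_add_mul_le_pow (a := -(2 * e)) (by linarith) (L - 1)
      rw [hn] at this
      rw [sub_eq_add_neg]
      linarith
    calc 5 / 8 * (q ^ (L - 1) * b) ≤ (1 - 2 * e) ^ (L - 1) * (q ^ (L - 1) * b) := by gcongr
      _ = b * ((1 - 2 * e) * q) ^ (L - 1) := by rw [mul_pow]; ring
      _ ≤ b * (1 + b - e) ^ (L - 1) := by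
        gcongr
        · have : 0 ≤ 1 - 2 * e := by linarith
          positivity
        · nlinarith
      _ ≤ F := hlow
  refine ⟨?_, by linarith⟩
  by_contra! hcon
  have hbL : b * L ≤ 8 / 5 := by
    have : 5 / 8 * (L * F * b) ≤ F := (by gcongr : _ ≤ _).trans hmain
    nlinarith
  have hexp : q ^ (L - 1) < Real.exp 2 := by
    calc q ^ (L - 1) ≤ Real.exp (b + e) ^ (L - 1) := by
          gcongr
          linarith [Real.add_one_le_exp (b + e)]
      _ = Real.exp ((L - 1) * (b + e)) := by rw [← Real.exp_nat_mul, hn]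
      _ < Real.exp 2 := by
        apply Real.exp_lt_exp.2
        nlinarith
  linarith

theorem toEuclideanCLM_transpose {d : ℕ} (A : Matrix (Fin d) (Fin d) ℝ) :
    toEuclideanCLM (𝕜 := ℝ) Aᵀ = star (toEuclideanCLM (𝕜 := ℝ) A) := by
  rw [← map_star, star_eq_conjTranspose, conjTranspose_eq_transpose_of_trivial]

theorem toEuclideanCLM_Dmat {d : ℕ} (W : ℕ → Matrix (Fin d) (Fin d) ℝ) (l : ℕ) :
    toEuclideanCLM (𝕜 := ℝ) (Dmat W l) =
      star (toEuclideanCLM (𝕜 := ℝ) (W (l + 1))) * toEuclideanCLM (𝕜 := ℝ) (W (l + 1)) -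
        toEuclideanCLM (𝕜 := ℝ) (W l) * star (toEuclideanCLM (𝕜 := ℝ) (W l)) := by
  simp only [Dmat, map_sub, map_mul, toEuclideanCLM_transpose]

theorem adjoint_seg_apply {d : ℕ} (W : ℕ → Matrix (Fin d) (Fin d) ℝ) (L : ℕ)
    (u : EuclideanSpace ℝ (Fin d)) : ∀ j ≤ L,
    adjoint (toEuclideanCLM (𝕜 := ℝ) (seg W 1 (L - j)))
      (adjointOrbit (fun i => toEuclideanCLM (𝕜 := ℝ) (W (L - i))) u j) =
    adjoint (toEuclideanCLM (𝕜 := ℝ) (seg W 1 L)) u := by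
  intro j
  induction j with
  | zero => intro _; rfl
  | succ j ih =>
    intro hj
    rw [← ih (by omega)]
    obtain ⟨k, hk⟩ : ∃ k, L - j = k + 1 := ⟨L - j - 1, by omega⟩
    have hk' : L - (j + 1) = k := by omega
    simp only [adjointOrbit, hk, hk', seg, if_neg (show ¬ k + 1 < 1 by omega), map_mul]
    rw [← star_eq_adjoint, ← star_eq_adjoint, ← star_eq_adjoint, star_mul, mul_apply_eq_comp]

/-- Lemma A.3, weight bounds: with `α = max{max_l ‖W_l‖₂, 1}`,
`β = ‖W_L‖₂`, `φ = max{‖W_{L:1}‖₂, e/√L, 1}`, approximate balancedness implies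
`α^{2(L-1)} < L φ²` and `α^{2(L-1)} β² < 2 φ²`. -/
theorem approx_balanced_weight_bounds
    (d L : ℕ) (hd : 1 ≤ d) (hL : 2 ≤ L)
    (W : ℕ → Matrix (Fin d) (Fin d) ℝ) (α β φ δ ε : ℝ)
    (hα : α = max ((Finset.Icc 1 (L-1)).sup' (Finset.nonempty_Icc.mpr (by omega))
      fun l => spec (W l)) 1)
    (hβ : β = spec (W L))
    (hφ : φ = max (max (spec (seg W 1 L)) (Real.exp 1 / Real.sqrt L)) 1)
    (hD : ∀ l, 1 ≤ l → l ≤ L - 2 → spec (Dmat W l) ≤ δ)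
    (hδ : δ ≤ (2 * (L:ℝ)^3 * φ^2)⁻¹)
    (hDL : spec (1 + Dmat W (L-1)) ≤ ε)
    (hε : ε ≤ (4 * (L:ℝ)^2)⁻¹) :
    α^(2*(L-1)) < L * φ^2 ∧ α^(2*(L-1)) * β^2 < 2 * φ^2 := by
  have hL2 : (2 : ℝ) ≤ L := by exact_mod_cast hL
  have hφ1 : 1 ≤ φ := hφ ▸ le_max_right _ _
  have hφs : spec (seg W 1 L) ≤ φ := hφ ▸ (le_max_left _ _).trans (le_max_left _ _)
  have hφe : Real.exp 1 / Real.sqrt L ≤ φ := hφ ▸ (le_max_right _ _).trans (le_max_left _ _)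
  have hα1 : 1 ≤ α := hα ▸ le_max_right _ _
  obtain ⟨n, rfl⟩ : ∃ n, L = n + 1 := ⟨L - 1, by omega⟩
  set V : ℕ → EuclideanSpace ℝ (Fin d) →L[ℝ] EuclideanSpace ℝ (Fin d) :=
    fun i => toEuclideanCLM (𝕜 := ℝ) (W (n + 1 - i)) with hVdef
  set δ₀ : ℝ := (2 * ((n + 1 : ℕ) : ℝ) ^ 3)⁻¹ with hδ₀
  set ε₀ : ℝ := (4 * ((n + 1 : ℕ) : ℝ) ^ 2)⁻¹ with hε₀
  have hδ₀0 : 0 ≤ δ₀ := by positivity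
  have hδδ₀ : δ ≤ δ₀ := by
    refine hδ.trans (inv_anti₀ (by positivity) ?_)
    exact le_mul_of_one_le_right (by positivity) (one_le_pow₀ hφ1)
  have he : ε₀ + n * δ₀ ≤ 3 / (4 * ((n + 1 : ℕ) : ℝ) ^ 2) := by
    calc ε₀ + n * δ₀ ≤ ε₀ + ((n + 1 : ℕ) : ℝ) * δ₀ := by gcongr; omega
      _ = 3 / (4 * ((n + 1 : ℕ) : ℝ) ^ 2) := by
        rw [hδ₀, hε₀]
        field_simp
        norm_num
  have he1 : ε₀ + n * δ₀ ≤ 1 := by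
    refine he.trans ((div_le_one (by positivity)).2 ?_)
    nlinarith
  have h0 : ‖1 + (star (V 0) * V 0 - V 1 * star (V 1))‖ ≤ ε₀ := by
    have h := hDL.trans hε
    rw [spec, map_add, map_one, toEuclideanCLM_Dmat, show n + 1 - 1 + 1 = n + 1 by omega] at h
    exact h
  have hV : ∀ j, 1 ≤ j → j < n →
      ‖star (V j) * V j - V (j + 1) * star (V (j + 1))‖ ≤ δ₀ := by
    intro j hj hjn
    have h := (hD (n - j) (by omega) (by omega)).trans hδδ₀
    rw [spec, toEuclideanCLM_Dmat, show n - j + 1 = n + 1 - j by omega] at h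
    simpa only [hVdef, show n + 1 - (j + 1) = n - j by omega] using h
  have hβV : ‖V 0‖ = β := hβ.symm
  obtain ⟨u, hu, hu'⟩ := exists_norm_le_one_norm_apply_eq (adjoint (V 0))
  rw [LinearIsometryEquiv.norm_map] at hu'
  have hlow := adjointOrbit_lower_bound V hδ₀0 he1 h0 hV hu hu'
  have hseg : ‖adjointOrbit V u (n + 1)‖ ≤ φ := by
    have h := adjoint_seg_apply W (n + 1) u (n + 1) le_rfl
    have h1 : adjoint (toEuclideanCLM (𝕜 := ℝ) (seg W 1 (n + 1 - (n + 1)))) =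
        (1 : EuclideanSpace ℝ (Fin d) →L[ℝ] EuclideanSpace ℝ (Fin d)) := by
      rw [Nat.sub_self, seg, map_one, ← star_eq_adjoint, star_one]
    rw [h1, one_apply_eq_self] at h
    rw [h]
    refine (unit_le_opNorm _ u hu).trans ?_
    rwa [LinearIsometryEquiv.norm_map]
  have hup := norm_sq_upper_bound V h0 hV
  have hα2 : α ^ 2 ≤ 1 + β ^ 2 + (ε₀ + n * δ₀) := by
    have hε₀0 : 0 ≤ ε₀ := by positivity
    have hnδ : 0 ≤ n * δ₀ := by positivity
    rcases max_choice ((Finset.Icc 1 (n + 1 - 1)).sup' (Finset.nonempty_Icc.mpr (by omega))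
      fun l => spec (W l)) 1 with h | h
    · obtain ⟨l, hl, hls⟩ := Finset.exists_mem_eq_sup'
        (Finset.nonempty_Icc.mpr (by omega : 1 ≤ n + 1 - 1)) fun l => spec (W l)
      rw [Finset.mem_Icc] at hl
      have h1 := hup (n - l) (by omega)
      have h2 : ‖V (n - l + 1)‖ = α := by
        rw [hα, h, hls]
        simp only [hVdef, show n + 1 - (n - l + 1) = l by omega, spec]
      rw [h2, hβV] at h1
      have h3 : ((n - l : ℕ) : ℝ) * δ₀ ≤ n * δ₀ := by gcongr; omega
      linarith
    · rw [hα, h]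
      nlinarith [sq_nonneg β]
  rw [hβV] at hlow
  have hFe : Real.exp 2 ≤ ((n + 1 : ℕ) : ℝ) * φ ^ 2 := by
    have h := pow_le_pow_left₀ (by positivity) hφe 2
    rw [div_pow, Real.sq_sqrt (by positivity), ← Real.exp_nat_mul, div_le_iff₀ (by positivity)] at h
    norm_num at h ⊢
    linarith
  have := scalar_weight_bounds hL (q := α ^ 2) (b := β ^ 2) (F := φ ^ 2) (e := ε₀ + n * δ₀)
    (one_le_pow₀ hα1) (sq_nonneg β) (by positivity) hFe (by positivity) he hα2 (by
      rw [← sub_sub]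
      exact hlow.trans (pow_le_pow_left₀ (norm_nonneg _) hseg 2))
  rwa [← pow_mul] at this
end
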